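/- If u ∈ ℝ^V satisfies (L(σ)u)|_{Ω⁺ ∪ ∂Ω} = 0 and u|_B = 0, then −𝒮(γ₁⁻u) + 𝒟⁻(γ₀u) = u·𝟙_{B ∪ Ω⁺ ∪ ∂Ω}, where 𝟙_X denotes the indicator vector of X ⊆ V and the product is componentwise. -/

import Mathlib

open Matrix BigOperators

noncomputable section

variable {V : Type*} [Fintype V] [DecidableEq V]

/-- Weighted graph Laplacian of a symmetric weight function. -/
def lap (σ : V → V → ℝ) : Matrix V V ℝ :=
  Matrix.of fun x y => if x = y then ∑ z, σ x z else -σ x y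

/-- Restriction matrix `R_X : ℝ^V → ℝ^X`. -/
def restr (X : Finset V) : Matrix {x // x ∈ X} V ℝ :=
  Matrix.of fun i j => if (i : V) = j then 1 else 0

/-- Green function `G = R_{V°}ᵀ (L[V°,V°])⁻¹ R_{V°}` with `V° = Bᶜ`. -/
def green (B : Finset V) (σ : V → V → ℝ) : Matrix V V ℝ :=
  (restr Bᶜ)ᵀ * (restr Bᶜ * lap σ * (restr Bᶜ)ᵀ)⁻¹ * restr Bᶜ

/-- Dirichlet trace operator `γ₀ = R_{∂Ω}`. -/
def gamma0 (dO : Finset V) : Matrix {x // x ∈ dO} V ℝ := restr dO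

/-- Exterior Neumann trace operator `γ₁⁺ = -R_{∂Ω} L(σ⁺)`. -/
def gamma1p (dO : Finset V) (σp : V → V → ℝ) : Matrix {x // x ∈ dO} V ℝ :=
  -(restr dO * lap σp)

/-- Interior Neumann trace operator `γ₁⁻ = R_{∂Ω} L(σ⁻)`. -/
def gamma1m (dO : Finset V) (σm : V → V → ℝ) : Matrix {x // x ∈ dO} V ℝ :=
  restr dO * lap σm

/-- Single layer potential `𝒮 = G γ₀ᵀ`. -/
def slp (B dO : Finset V) (σ : V → V → ℝ) : Matrix V {x // x ∈ dO} ℝ :=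
  green B σ * (gamma0 dO)ᵀ

/-- Exterior double layer potential `𝒟⁺ = G (γ₁⁺)ᵀ`. -/
def dlpP (B dO : Finset V) (σ σp : V → V → ℝ) : Matrix V {x // x ∈ dO} ℝ :=
  green B σ * (gamma1p dO σp)ᵀ

/-- Interior double layer potential `𝒟⁻ = G (γ₁⁻)ᵀ`. -/
def dlpM (B dO : Finset V) (σ σm : V → V → ℝ) : Matrix V {x // x ∈ dO} ℝ :=
  green B σ * (gamma1m dO σm)ᵀ

/-- Single layer boundary operator `S = γ₀ 𝒮`. -/
def Sop (B dO : Finset V) (σ : V → V → ℝ) : Matrix {x // x ∈ dO} {x // x ∈ dO} ℝ :=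
  gamma0 dO * slp B dO σ

/-- Double layer boundary operator `D = ½ γ₀ (𝒟⁺ + 𝒟⁻)`. -/
def Dop (B dO : Finset V) (σ σp σm : V → V → ℝ) : Matrix {x // x ∈ dO} {x // x ∈ dO} ℝ :=
  (1/2 : ℝ) • (gamma0 dO * (dlpP B dO σ σp + dlpM B dO σ σm))

/-- Adjoint double layer (Neumann–Poincaré) operator `D' = ½ (γ₁⁺ + γ₁⁻) 𝒮`. -/
def Dadj (B dO : Finset V) (σ σp σm : V → V → ℝ) : Matrix {x // x ∈ dO} {x // x ∈ dO} ℝ :=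
  (1/2 : ℝ) • ((gamma1p dO σp + gamma1m dO σm) * slp B dO σ)

/-- Hypersingular operator `H = -γ₁⁺ 𝒟⁻`. -/
def Hop (B dO : Finset V) (σ σp σm : V → V → ℝ) : Matrix {x // x ∈ dO} {x // x ∈ dO} ℝ :=
  -(gamma1p dO σp * dlpM B dO σ σm)

/-- Indicator vector of a node subset. -/
def ind (X : Finset V) : V → ℝ := fun x => if x ∈ X then 1 else 0

/-- The subgraph with node set `A` and edges `{x,y}` with `w x y > 0` is connected. -/
def connOn (A : Finset V) (w : V → V → ℝ) : Prop :=
  ∀ x ∈ A, ∀ y ∈ A, Relation.ReflTransGen (fun a b => a ∈ A ∧ b ∈ A ∧ 0 < w a b) x y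

theorem restr_mulVec (X : Finset V) (w : V → ℝ) : restr X *ᵥ w = fun i : {x // x ∈ X} => w i := by
  ext i
  simp [restr, Matrix.mulVec, dotProduct]

theorem restr_transpose_mulVec_restr (X : Finset V) (w : V → ℝ) :
    (restr X)ᵀ *ᵥ (restr X *ᵥ w) = w * ind X := by
  ext x
  rw [restr_mulVec]
  have h := Finset.sum_coe_sort X fun y => if y = x then w y else 0
  simpa [restr, Matrix.mulVec, dotProduct, ind] using h

theorem lap_mulVec_apply {σ : V → V → ℝ} (hdiag : ∀ x, σ x x = 0) (w : V → ℝ) (x : V) :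
    (lap σ *ᵥ w) x = ∑ y, σ x y * (w x - w y) := by
  have h : ∀ y, lap σ x y * w y =
      (if x = y then (∑ z, σ x z) * w x else 0) - σ x y * w y := by
    intro y
    by_cases hxy : x = y
    · subst hxy
      simp [lap, hdiag]
    · simp [lap, hxy]
  simp only [Matrix.mulVec, dotProduct, h, mul_sub, Finset.sum_sub_distrib, Finset.sum_mul]
  simp

theorem lap_transpose {σ : V → V → ℝ} (hsymm : ∀ x y, σ x y = σ y x) : (lap σ)ᵀ = lap σ := by
  ext x y
  by_cases hxy : x = y
  · simp [hxy]
  · simp [lap, hxy, Ne.symm hxy, hsymm y x]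

/-- The Green function recovers a vector vanishing on `B` from its Laplacian off `B`. -/
theorem green_mulVec_eq {B : Finset V} {σ : V → V → ℝ}
    (hdet : IsUnit (restr Bᶜ * lap σ * (restr Bᶜ)ᵀ).det) {f w : V → ℝ}
    (hw : ∀ x ∈ B, w x = 0) (hf : ∀ x ∉ B, (lap σ *ᵥ w) x = f x) :
    green B σ *ᵥ f = w := by
  have hext : (restr Bᶜ)ᵀ *ᵥ (restr Bᶜ *ᵥ w) = w := by
    rw [restr_transpose_mulVec_restr]
    ext x
    by_cases hx : x ∈ B <;> simp [ind, hx, hw]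
  have hres : restr Bᶜ *ᵥ f = (restr Bᶜ * lap σ * (restr Bᶜ)ᵀ) *ᵥ (restr Bᶜ *ᵥ w) := by
    rw [← Matrix.mulVec_mulVec, hext, ← Matrix.mulVec_mulVec, restr_mulVec, restr_mulVec]
    ext i
    exact (hf i (Finset.mem_compl.mp i.2)).symm
  have hinv : (restr Bᶜ * lap σ * (restr Bᶜ)ᵀ)⁻¹ *ᵥ (restr Bᶜ *ᵥ f) = restr Bᶜ *ᵥ w := by
    rw [hres, Matrix.mulVec_mulVec, Matrix.nonsing_inv_mul _ hdet, Matrix.one_mulVec]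
  rw [green, ← Matrix.mulVec_mulVec, ← Matrix.mulVec_mulVec, hinv, hext]

theorem stmt_4
    {V : Type*} [Fintype V] [DecidableEq V]
    (B Op dO Om : Finset V)
    (hBne : B.Nonempty) (hOpne : Op.Nonempty) (hdOne : dO.Nonempty) (hOmne : Om.Nonempty)
    (hd1 : Disjoint B Op) (hd2 : Disjoint B dO) (hd3 : Disjoint B Om)
    (hd4 : Disjoint Op dO) (hd5 : Disjoint Op Om) (hd6 : Disjoint dO Om)
    (hcover : B ∪ Op ∪ dO ∪ Om = Finset.univ)
    (σ σp σm : V → V → ℝ)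
    (hσsymm : ∀ x y, σ x y = σ y x) (hσdiag : ∀ x, σ x x = 0)
    (hσnn : ∀ x y, 0 ≤ σ x y)
    (hsepBdO : ∀ x ∈ B, ∀ y ∈ dO, σ x y = 0)
    (hsepBOm : ∀ x ∈ B, ∀ y ∈ Om, σ x y = 0)
    (hsepOpOm : ∀ x ∈ Op, ∀ y ∈ Om, σ x y = 0)
    (hσpsymm : ∀ x y, σp x y = σp y x) (hσpdiag : ∀ x, σp x x = 0)
    (hσmsymm : ∀ x y, σm x y = σm y x) (hσmdiag : ∀ x, σm x x = 0)
    (hσpnn : ∀ x y, 0 ≤ σp x y) (hσmnn : ∀ x y, 0 ≤ σm x y)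
    (hsum : ∀ x y, σp x y + σm x y = σ x y)
    (hp1 : ∀ x y, x ∈ B ∪ Op ∨ y ∈ B ∪ Op → σp x y = σ x y)
    (hm1 : ∀ x y, x ∈ Om ∨ y ∈ Om → σm x y = σ x y)
    (hpd : (restr Bᶜ * lap σ * (restr Bᶜ)ᵀ).PosDef) :
    ∀ u : V → ℝ, (∀ x ∈ Op ∪ dO, (lap σ *ᵥ u) x = 0) → (∀ x ∈ B, u x = 0) →
      -(slp B dO σ *ᵥ (gamma1m dO σm *ᵥ u)) + dlpM B dO σ σm *ᵥ (gamma0 dO *ᵥ u)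
        = u * ind (B ∪ Op ∪ dO) := by
  intro u hu huB
  have hlhs : -(slp B dO σ *ᵥ (gamma1m dO σm *ᵥ u)) + dlpM B dO σ σm *ᵥ (gamma0 dO *ᵥ u)
      = green B σ *ᵥ (-((lap σm *ᵥ u) * ind dO) + lap σm *ᵥ (u * ind dO)) := by
    simp only [slp, dlpM, gamma0, gamma1m, Matrix.transpose_mul, lap_transpose hσmsymm,
      ← Matrix.mulVec_mulVec, restr_transpose_mulVec_restr, Matrix.mulVec_add,
      Matrix.mulVec_neg]
  rw [hlhs]
  refine green_mulVec_eq hpd.det_pos.ne'.isUnit (fun x hx => by simp [huB x hx]) ?_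
  intro x hxB
  have hdisj : ∀ y, (y ∈ B ∧ y ∉ Op ∧ y ∉ dO ∧ y ∉ Om) ∨ (y ∉ B ∧ y ∈ Op ∧ y ∉ dO ∧ y ∉ Om) ∨
      (y ∉ B ∧ y ∉ Op ∧ y ∈ dO ∧ y ∉ Om) ∨ (y ∉ B ∧ y ∉ Op ∧ y ∉ dO ∧ y ∈ Om) := by
    intro y
    have hy := hcover ▸ Finset.mem_univ y
    simp only [Finset.mem_union] at hy
    rw [Finset.disjoint_left] at hd1 hd2 hd3 hd4 hd5 hd6
    grind
  have hm0 : ∀ x y, x ∈ Op ∨ y ∈ Op → σm x y = 0 := by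
    intro x y h
    have := hp1 x y (by simp only [Finset.mem_union]; tauto)
    linarith [hsum x y]
  simp only [Pi.add_apply, Pi.neg_apply, Pi.mul_apply, lap_mulVec_apply hσdiag,
    lap_mulVec_apply hσmdiag]
  rcases hdisj x with hx | hx | hx | hx
  · exact absurd hx.1 hxB
  · have h := hu x (by simp [hx])
    rw [lap_mulVec_apply hσdiag] at h
    have hL : ∀ y, σ x y * (u x * ind (B ∪ Op ∪ dO) x - u y * ind (B ∪ Op ∪ dO) y)
        = σ x y * (u x - u y) := by
      intro y
      rcases hdisj y with hy | hy | hy | hy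
      on_goal 4 => simp [hsepOpOm x hx.2.1 y hy.2.2.2]
      all_goals simp [ind, hx, hy]
    simp only [hL, h, hm0 x _ (Or.inl hx.2.1)]
    simp [ind, hx]
  · have h := hu x (by simp [hx])
    rw [lap_mulVec_apply hσdiag] at h
    have hx1 : ind dO x = 1 := by simp [ind, hx]
    rw [hx1, mul_one, ← Finset.sum_neg_distrib, ← Finset.sum_add_distrib,
      ← sub_zero (∑ y, σ x y * _), ← h, ← Finset.sum_sub_distrib]
    refine Finset.sum_congr rfl fun y _ => ?_
    rcases hdisj y with hy | hy | hy | hy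
    · simp [ind, hx, hy, huB y hy.1]
    · simp [ind, hx, hy, hm0 x y (Or.inr hy.2.1)]
    · simp [ind, hx, hy]
    · simp [ind, hx, hy, hm1 x y (Or.inr hy.2.2.2)]
      ring
  · have hx1 : ind dO x = 0 := by simp [ind, hx]
    rw [hx1, mul_zero, neg_zero, zero_add]
    refine Finset.sum_congr rfl fun y _ => ?_
    rw [hm1 x y (Or.inl hx.2.2.2)]
    rcases hdisj y with hy | hy | hy | hy
    · simp [ind, hx, hy, huB y hy.1]
    · simp [hσsymm x y, hsepOpOm y hy.2.1 x hx.2.2.2]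
    · simp [ind, hx, hy]
    · simp [ind, hx, hy]
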